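/- Let K be a separably closed field and f ∈ K[x] a polynomial of degree d ≥ 2 with euclidean orbifold of type (2,2,∞); assume char(K) = 0 or char(K) does not divide the local degree of any point of P^1_K. Write P_f = {p_1, p_2, ∞} with p_1, p_2 the finite post-critical points. Then G_∞(K,f,t) is the closure in Aut(T) of the subgroup ⟨g_{p_1}, g_{p_2}⟩ generated by the two finite inertia topological generators, and ⟨g_{p_1}, g_{p_2}⟩ is an infinite dihedral group: g_{p_1} and g_{p_2} have order 2 and their product g_{p_1} g_{p_2} has infinite order (indeed it is level-transitive). -/

import Mathlib

set_option synthInstance.maxHeartbeats 1000000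
set_option maxHeartbeats 2000000

open Polynomial MeasureTheory

namespace ArbGal
/-- The projective line `P¹(K) = K ∪ {∞}`; `none` is the point at infinity. -/
abbrev P1 (K : Type*) := Option K

section PolyDyn

variable (K : Type*) [Field K]

/-- The local degree (ramification index) of the polynomial `f` at a finite point
`z`: the order of vanishing of `f(x) − f(z)` at `z`. -/
noncomputable def ldeg (f : Polynomial K) (z : K) : ℕ :=
  Polynomial.rootMultiplicity z (f - Polynomial.C (f.eval z))

/-- The self-map of `P¹(K)` induced by a polynomial (fixing `∞`). -/
def evalP (f : Polynomial K) : P1 K → P1 K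
  | Option.some z => Option.some (f.eval z)
  | Option.none => Option.none

/-- The local degree of the polynomial `f` at a point of `P¹(K)`; at `∞` it is
`deg f`, since `∞` is totally ramified. -/
noncomputable def ldegP (f : Polynomial K) : P1 K → ℕ
  | Option.some z => ldeg K f z
  | Option.none => f.natDegree

/-- The set `C_f ⊆ P¹(K)` of critical points of a polynomial. -/
def Crit (f : Polynomial K) : Set (P1 K) := {z | 2 ≤ ldegP K f z}

/-- The post-critical set `P_f = ⋃_{n ≥ 1} f^n(C_f) ⊆ P¹(K)` of a polynomial. -/
def PostCrit (f : Polynomial K) : Set (P1 K) :=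
  {w | ∃ n : ℕ, 1 ≤ n ∧ ∃ c ∈ Crit K f, (evalP K f)^[n] c = w}

/-- A set `Σ ⊆ P_f` is exceptional if `Σ = f⁻¹(Σ) \\ C_f`. -/
def IsExc (f : Polynomial K) (s : Set (P1 K)) : Prop :=
  s ⊆ PostCrit K f ∧ s = (evalP K f) ⁻¹' s \ Crit K f

/-- The maximal exceptional set `Σ_f` (the union of all exceptional sets). -/
def maxExc (f : Polynomial K) : Set (P1 K) := ⋃₀ {s | IsExc K f s}

/-- A set `Υ ⊆ P_f` is critically exceptional if
`Υ = f⁻¹(Υ) \\ ((C_f ∪ P_f) \\ Υ)`. -/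
def IsCritExc (f : Polynomial K) (s : Set (P1 K)) : Prop :=
  s ⊆ PostCrit K f ∧ s = (evalP K f) ⁻¹' s \ ((Crit K f ∪ PostCrit K f) \ s)

/-- The maximal critically exceptional set `Υ_f`. -/
def maxCritExc (f : Polynomial K) : Set (P1 K) := ⋃₀ {s | IsCritExc K f s}

/-- `Δ_f`: the set of post-critical points all of whose preimages are critical or
post-critical. -/
def Deltaf (f : Polynomial K) : Set (P1 K) :=
  {p ∈ PostCrit K f | (evalP K f) ⁻¹' {p} ⊆ Crit K f ∪ PostCrit K f}

/-- The iterate `f^n` of a polynomial, as a polynomial. -/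
noncomputable def iterP (f : Polynomial K) : ℕ → Polynomial K
  | 0 => Polynomial.X
  | n + 1 => f.comp (iterP f n)

/-- The set of local degrees `e_{f^n}(w)` over all finite backward orbits of a
finite point `z`; the orbifold multiplicity `ν_f(z)` is its least common multiple
(`∞` if it is unbounded). -/
def branchSet (f : Polynomial K) (z : K) : Set ℕ :=
  {e | ∃ n : ℕ, 1 ≤ n ∧ ∃ w : K, (iterP K f n).eval w = z ∧ ldeg K (iterP K f n) w = e}

/-- `ν_f(z) = m` (a finite value): `m` is the least common multiple of the branch
data of `f` over `z`. -/
def nuEq (f : Polynomial K) (z : K) (m : ℕ) : Prop :=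
  (∀ e ∈ branchSet K f z, e ∣ m) ∧ ∀ m' : ℕ, (∀ e ∈ branchSet K f z, e ∣ m') → m ∣ m'

/-- A polynomial of degree `≥ 2` has a euclidean (Thurston) orbifold of type
`(2,2,∞)`: the orbifold multiplicity `ν_f` equals `2` at exactly two finite points
and `1` at every other finite point (the third orbifold point being `∞`, where
`ν_f(∞) = ∞` automatically since `∞` is a totally ramified, hence super-attracting,
fixed point). -/
def HasEuclid22Inf (f : Polynomial K) : Prop :=
  ∃ p₁ p₂ : K, p₁ ≠ p₂ ∧ nuEq K f p₁ 2 ∧ nuEq K f p₂ 2 ∧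
    ∀ z : K, z ≠ p₁ → z ≠ p₂ → nuEq K f z 1

/-- Tameness: `char K = 0`, or `char K` does not divide the local degree of `f` at
any point of `P¹(K)`. -/
def TameAll (f : Polynomial K) : Prop :=
  ringChar K = 0 ∨ ∀ z : P1 K, ¬ (ringChar K ∣ ldegP K f z)

/-- Tameness at critical points: `char K = 0`, or `char K` does not divide the local
degree of `f` at any critical point of `f` (including `∞`). -/
def TameCrit (f : Polynomial K) : Prop :=
  ringChar K = 0 ∨ ∀ z ∈ Crit K f, ¬ (ringChar K ∣ ldegP K f z)

/-- `g` is a standard twisted Chebyshev polynomial of degree `d`: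
`g(x + 1/x) = x^d + ζ/x^d` for some `ζ` with `ζ^(d−1) = 1`. -/
def IsStdTwistedCheb (g : Polynomial K) (d : ℕ) : Prop :=
  ∃ ζ : K, ζ ^ (d - 1) = 1 ∧
    (Polynomial.aeval (RatFunc.X + (RatFunc.X)⁻¹) g : RatFunc K)
      = RatFunc.X ^ d + algebraMap K (RatFunc K) ζ * ((RatFunc.X)⁻¹) ^ d

/-- `f` is a twisted Chebyshev polynomial: it is linearly conjugate (over `K`) to a
standard twisted Chebyshev polynomial. -/
def IsTwistedCheb (f : Polynomial K) : Prop :=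
  ∃ g : Polynomial K, IsStdTwistedCheb K g f.natDegree ∧
    ∃ a b : K, a ≠ 0 ∧
      (Polynomial.C a * Polynomial.X + Polynomial.C b).comp f
        = g.comp (Polynomial.C a * Polynomial.X + Polynomial.C b)

/-- `g = ±T_d` where `T_d` is the `d`-th Chebyshev polynomial, i.e. the unique
polynomial with `g(x + 1/x) = ±(x^d + 1/x^d)`. -/
def IsPMCheb (g : Polynomial K) (d : ℕ) : Prop :=
  (Polynomial.aeval (RatFunc.X + (RatFunc.X)⁻¹) g : RatFunc K)
      = RatFunc.X ^ d + ((RatFunc.X)⁻¹) ^ d ∨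
  (Polynomial.aeval (RatFunc.X + (RatFunc.X)⁻¹) g : RatFunc K)
      = -(RatFunc.X ^ d + ((RatFunc.X)⁻¹) ^ d)

end PolyDyn

/-- The rational function field `K(t)`, with `t = RatFunc.X` a transcendental
element over `K`. -/
abbrev Fr (K : Type) [Field K] := RatFunc K

/-- A separable closure of `K(t)`, realized inside an algebraic closure. -/
noncomputable def Ssep (K : Type) [Field K] :
    IntermediateField (Fr K) (AlgebraicClosure (Fr K)) :=
  separableClosure (Fr K) (AlgebraicClosure (Fr K))

/-- The separable closure of `K(t)`, as a field. -/
abbrev Sf (K : Type) [Field K] := ↥(Ssep K)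

/-- The image of `t` in the separable closure of `K(t)`. -/
noncomputable def tS (K : Type) [Field K] : Sf K := algebraMap (Fr K) (Sf K) RatFunc.X

/-- A polynomial over `K`, viewed over `K(t)`. -/
noncomputable def fF (K : Type) [Field K] (f : Polynomial K) : Polynomial (Fr K) :=
  f.map (algebraMap K (Fr K))

/-- The `n`-th level `f^{-n}(t)` of the tree of preimages of `t`, inside the
separable closure of `K(t)`. -/
noncomputable def preimS (K : Type) [Field K] (f : Polynomial K) : ℕ → Set (Sf K)
  | 0 => {tS K}
  | n + 1 => {s | Polynomial.aeval s (fF K f) ∈ preimS K f n}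

/-- The field `K_∞(f,t)`, generated over `K(t)` by all the preimages
`⋃_n f^{-n}(t)`. -/
noncomputable def KinfI (K : Type) [Field K] (f : Polynomial K) :
    IntermediateField (Fr K) (Sf K) :=
  IntermediateField.adjoin (Fr K) (⋃ n, preimS K f n)

/-- The field `K_∞(f,t)` as a type. -/
abbrev Kinf (K : Type) [Field K] (f : Polynomial K) := ↥(KinfI K f)

/-- The geometric iterated Galois group `G_∞(K,f,t) = Gal(K_∞(f,t)/K(t))`,
equipped with its Krull topology. -/
abbrev Gal (K : Type) [Field K] (f : Polynomial K) := Kinf K f ≃ₐ[Fr K] Kinf K f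

/-- The Borel σ-algebra on the Galois group (for its Krull topology). -/
noncomputable instance (K : Type) [Field K] (f : Polynomial K) :
    MeasurableSpace (Gal K f) := borel _

/-- The element `t` inside `K_∞(f,t)`. -/
noncomputable def tK (K : Type) [Field K] (f : Polynomial K) : Kinf K f :=
  algebraMap (Fr K) (Kinf K f) RatFunc.X

/-- The `n`-th level of the preimage tree, inside `K_∞(f,t)`. -/
noncomputable def preimK (K : Type) [Field K] (f : Polynomial K) (n : ℕ) :
    Set (Kinf K f) := {s | (s : Sf K) ∈ preimS K f n}

/-- `σ` fixes an end of the tree of preimages `T_t`: there is an infinite rooted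
path `t = s_0, s_1, s_2, …` with `f(s_{n+1}) = s_n`, each of whose vertices is
fixed by `σ`. -/
noncomputable def FixesEndGal (K : Type) [Field K] (f : Polynomial K)
    (σ : Gal K f) : Prop :=
  ∃ s : ℕ → Kinf K f, s 0 = tK K f ∧
    (∀ n, Polynomial.aeval (s (n + 1)) (fF K f) = s n) ∧
    ∀ n, σ (s n) = s n

/-- The fixed-point process on the Galois group: `X_n(σ)` is the number of elements
of `f^{-n}(t)` fixed by `σ`. -/
noncomputable def XfixGal (K : Type) [Field K] (f : Polynomial K) (n : ℕ)
    (σ : Gal K f) : ℕ :=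
  Set.ncard {s ∈ preimK K f n | σ s = s}

/-- The fixed-point process of `G_∞(K,f,t)` is a martingale with respect to `μ`. -/
noncomputable def FPMartingaleGal (K : Type) [Field K] (f : Polynomial K)
    (μ : Measure (Gal K f)) : Prop :=
  (∀ n : ℕ, 1 ≤ n → Integrable (fun σ : Gal K f => (XfixGal K f n σ : ℝ)) μ) ∧
  ∀ n : ℕ, 1 ≤ n → ∀ t : ℕ → ℝ,
    μ {σ : Gal K f | ∀ i, 1 ≤ i → i ≤ n → (XfixGal K f i σ : ℝ) = t i} ≠ 0 →
    ∫ σ in {σ : Gal K f | ∀ i, 1 ≤ i → i ≤ n → (XfixGal K f i σ : ℝ) = t i},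
        (XfixGal K f (n + 1) σ : ℝ) ∂μ
      = t n * (μ {σ : Gal K f | ∀ i, 1 ≤ i → i ≤ n → (XfixGal K f i σ : ℝ) = t i}).toReal


/-- The element of `K(t)` cutting out the place of `K(t)` corresponding to the point
`p ∈ P¹(K)`: `t − p` for a finite point, and `1/t` for `p = ∞`. -/
noncomputable def uPt (K : Type) [Field K] (pt : P1 K) : Fr K :=
  match pt with
  | Option.some a => RatFunc.X - algebraMap K (Fr K) a
  | Option.none => (RatFunc.X)⁻¹

/-- The coordinate ring `K[t − p]` (resp. `K[1/t]`) of the affine chart of `P¹`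
adapted to the point `p`. -/
noncomputable def Rbase (K : Type) [Field K] (pt : P1 K) : Subalgebra K (Fr K) :=
  Algebra.adjoin K {uPt K pt}

/-- The ring `O_∞`: the integral closure of the coordinate ring adapted to `p`
inside `K_∞(f,t)`. -/
noncomputable def Oord (K : Type) [Field K] (f : Polynomial K) (pt : P1 K) :
    Subalgebra ↥(Rbase K pt) (Kinf K f) :=
  integralClosure ↥(Rbase K pt) (Kinf K f)

/-- `𝔓` is a prime of `O_∞` lying above the prime `(t − p)` (resp. `(1/t)` for
`p = ∞`). -/
noncomputable def IsPrimeOver (K : Type) [Field K] (f : Polynomial K) (pt : P1 K)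
    (𝔓 : Ideal ↥(Oord K f pt)) : Prop :=
  𝔓.IsPrime ∧
    Ideal.comap (algebraMap ↥(Rbase K pt) ↥(Oord K f pt)) 𝔓
      = Ideal.span {⟨uPt K pt, Algebra.self_mem_adjoin_singleton K _⟩}

/-- The inertia subgroup `I_𝔓 ≤ G_∞(K,f,t)` of a prime `𝔓` of `O_∞`: the elements
acting trivially on the residue ring `O_∞/𝔓` (such elements automatically stabilize
`𝔓`). -/
noncomputable def inertiaSet (K : Type) [Field K] (f : Polynomial K) (pt : P1 K)
    (𝔓 : Ideal ↥(Oord K f pt)) : Set (Gal K f) :=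
  {σ | ∀ x : ↥(Oord K f pt), ∃ h : σ (x : Kinf K f) ∈ Oord K f pt,
      (⟨σ (x : Kinf K f), h⟩ - x : ↥(Oord K f pt)) ∈ 𝔓}

/-- `g` is a family of inertia topological generators for `G_∞(K,f,t)`:
for each post-critical point `p`, `g p` topologically generates the inertia subgroup
of a prime above `(t − p)`; the family topologically generates `G_∞(K,f,t)`; and
(when `P_f` is finite) it admits an ordering whose product is `1`. -/
noncomputable def InertiaGenFamily (K : Type) [Field K] (f : Polynomial K)
    (g : P1 K → Gal K f) : Prop :=
  (∀ pt ∈ PostCrit K f, ∃ 𝔓 : Ideal ↥(Oord K f pt), IsPrimeOver K f pt 𝔓 ∧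
      closure ((Subgroup.zpowers (g pt) : Subgroup (Gal K f)) : Set (Gal K f))
        = inertiaSet K f pt 𝔓) ∧
  closure ((Subgroup.closure (g '' PostCrit K f) : Subgroup (Gal K f)) : Set (Gal K f))
      = Set.univ ∧
  ∀ _ : (PostCrit K f).Finite, ∃ l : List (P1 K), l.Nodup ∧
    (∀ x : P1 K, x ∈ l ↔ x ∈ PostCrit K f) ∧ (l.map g).prod = 1

lemma card_image_add_card_image_le {X L : Type*} [Fintype X] [DecidableEq L]
    (ρ₁ ρ₂ : X → L)
    (hconst : ∀ h : X → ℚ, (∀ x y, ρ₁ x = ρ₁ y → h x = h y) →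
      (∀ x y, ρ₂ x = ρ₂ y → h x = h y) → ∀ x y, h x = h y) :
    (Finset.univ.image ρ₁).card + (Finset.univ.image ρ₂).card ≤ Fintype.card X + 1 := by
  classical
  have key : ∀ ρ : X → L, ∃ V : Submodule ℚ (X → ℚ),
      Module.finrank ℚ V = (Finset.univ.image ρ).card ∧
      ∀ h ∈ V, ∀ x y, ρ x = ρ y → h x = h y := by
    intro ρ
    let r : X → Finset.univ.image ρ := fun x => ⟨ρ x, Finset.mem_image_of_mem ρ (Finset.mem_univ x)⟩
    have hr : Function.Surjective r := by
      rintro ⟨y, hy⟩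
      obtain ⟨x, -, hx⟩ := Finset.mem_image.1 hy
      exact ⟨x, Subtype.ext hx⟩
    refine ⟨LinearMap.range (LinearMap.funLeft ℚ ℚ r), ?_, ?_⟩
    · rw [LinearMap.finrank_range_of_inj (LinearMap.funLeft_injective_of_surjective ℚ ℚ r hr)]
      simp
    · rintro h ⟨u, rfl⟩ x y hxy
      have : r x = r y := Subtype.ext hxy
      simp [LinearMap.funLeft, this]
  obtain ⟨V, hV, hV'⟩ := key ρ₁
  obtain ⟨W, hW, hW'⟩ := key ρ₂
  have h1 := Submodule.finrank_sup_add_finrank_inf_eq V W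
  have h2 : Module.finrank ℚ ↥(V ⊔ W) ≤ Fintype.card X := by
    simpa using Submodule.finrank_le (V ⊔ W)
  have h3 : Module.finrank ℚ ↥(V ⊓ W) ≤ 1 := by
    have hle : V ⊓ W ≤ Submodule.span ℚ {(1 : X → ℚ)} := by
      intro h hh
      rw [Submodule.mem_span_singleton]
      have hc := hconst h (hV' h hh.1) (hW' h hh.2)
      rcases isEmpty_or_nonempty X with hX | ⟨⟨x₀⟩⟩
      · exact ⟨0, Subsingleton.elim _ _⟩
      · refine ⟨h x₀, funext fun x => ?_⟩
        simp [hc x x₀]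
    exact (Submodule.finrank_mono hle).trans
      ((finrank_span_le_card ({(1 : X → ℚ)} : Set (X → ℚ))).trans (by simp))
  omega

lemma rootMultiplicity_le_derivative_of_natCast_eq_zero {L : Type*} [Field L] {p : L[X]}
    (hp : derivative p ≠ 0) {r : L} (h : (p.rootMultiplicity r : L) = 0) :
    p.rootMultiplicity r ≤ (derivative p).rootMultiplicity r := by
  rw [le_rootMultiplicity_iff hp]
  obtain ⟨q, hq⟩ := p.pow_rootMultiplicity_dvd r
  refine ⟨derivative q, ?_⟩
  conv_lhs => rw [hq]
  rw [derivative_mul, derivative_X_sub_C_pow, h]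
  simp

/-- The Riemann-Hurwitz count for the fibres of a polynomial over two distinct points. -/
lemma card_roots_sub_C_add {L : Type*} [Field L] [IsAlgClosed L] [DecidableEq L] {F : L[X]}
    (hN : (F.natDegree : L) ≠ 0) {a b : L} (hab : a ≠ b) :
    F.natDegree + 1 ≤ (F - C a).roots.toFinset.card + (F - C b).roots.toFinset.card ∧
    ((F - C a).roots.toFinset.card + (F - C b).roots.toFinset.card ≤ F.natDegree + 1 →
      (∀ r ∈ (F - C a).roots, ((F - C a).rootMultiplicity r : L) ≠ 0) ∧
      (∀ r ∈ (F - C b).roots, ((F - C b).rootMultiplicity r : L) ≠ 0)) := by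
  have hN0 : F.natDegree ≠ 0 := fun h => hN (by simp [h])
  have hd : ∀ c, derivative (F - C c) = derivative F := fun c => by simp
  have hF' : derivative F ≠ 0 := by
    intro h
    have := congrArg (fun p => coeff p (F.natDegree - 1)) h
    simp only [coeff_derivative, coeff_zero] at this
    rw [Nat.sub_add_cancel (Nat.pos_of_ne_zero hN0)] at this
    have e : ((F.natDegree - 1 : ℕ) : L) + 1 = (F.natDegree : L) := by
      exact_mod_cast congrArg (Nat.cast : ℕ → L) (Nat.sub_add_cancel (Nat.pos_of_ne_zero hN0))
    rw [e, mul_eq_zero] at this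
    rcases this with h1 | h1
    · have : F = 0 := by simpa using h1
      simp [this] at hN0
    · exact hN h1
  have hdeg : (derivative F).natDegree < F.natDegree := natDegree_derivative_lt hN0
  have hsum : ∀ c, ∑ r ∈ (F - C c).roots.toFinset, (F - C c).rootMultiplicity r = F.natDegree := by
    intro c
    have h1 : (F - C c).roots.card = F.natDegree := by
      rw [← (IsAlgClosed.splits (F - C c)).natDegree_eq_card_roots, natDegree_sub_C]
    rw [← h1, ← Multiset.toFinset_sum_count_eq]
    simp [count_roots]
  set A := (F - C a).roots.toFinset with hA
  set B := (F - C b).roots.toFinset with hB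
  have hdisj : Disjoint A B := by
    rw [Finset.disjoint_left]
    intro r h1 h2
    rw [hA, Multiset.mem_toFinset, mem_roots'] at h1
    rw [hB, Multiset.mem_toFinset, mem_roots'] at h2
    apply hab
    have e1 := h1.2
    have e2 := h2.2
    simp only [IsRoot.def, eval_sub, eval_C, sub_eq_zero] at e1 e2
    rw [← e1, e2]
  have hAB : ∑ r ∈ A, (derivative F).rootMultiplicity r +
      ∑ r ∈ B, (derivative F).rootMultiplicity r ≤ (derivative F).natDegree := by
    rw [← Finset.sum_union hdisj]
    refine le_trans ?_ (card_roots' _)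
    simp_rw [← count_roots]
    refine (Finset.sum_le_sum_of_ne_zero ?_).trans (Multiset.toFinset_sum_count_eq _).le
    intro x _ hx
    rw [Multiset.mem_toFinset]
    exact Multiset.count_ne_zero.1 hx
  have hle : ∀ c, ∀ r, (F - C c).rootMultiplicity r ≤ (derivative F).rootMultiplicity r + 1 := by
    intro c r
    have := rootMultiplicity_sub_one_le_derivative_rootMultiplicity_of_ne_zero (F - C c) r
      (by rw [hd]; exact hF')
    rw [hd] at this
    omega
  have hle' : ∀ c, F.natDegree ≤ ∑ r ∈ (F - C c).roots.toFinset, (derivative F).rootMultiplicity r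
      + (F - C c).roots.toFinset.card := by
    intro c
    rw [← hsum c, Finset.card_eq_sum_ones, ← Finset.sum_add_distrib]
    exact Finset.sum_le_sum fun r _ => hle c r
  have hlt : ∀ c, ∀ r ∈ (F - C c).roots, ((F - C c).rootMultiplicity r : L) = 0 →
      F.natDegree < ∑ r ∈ (F - C c).roots.toFinset, (derivative F).rootMultiplicity r
      + (F - C c).roots.toFinset.card := by
    intro c r hr h0
    nth_rw 1 [← hsum c]
    rw [Finset.card_eq_sum_ones, ← Finset.sum_add_distrib]
    refine Finset.sum_lt_sum (fun r _ => hle c r) ⟨r, by simpa using hr, ?_⟩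
    have := rootMultiplicity_le_derivative_of_natCast_eq_zero (p := F - C c)
      (by rw [hd]; exact hF') h0
    rw [hd] at this
    omega
  have ha := hle' a
  have hb := hle' b
  rw [← hA] at ha
  rw [← hB] at hb
  refine ⟨by omega, fun h => ⟨fun r hr h0 => ?_, fun r hr h0 => ?_⟩⟩
  · have := hlt a r hr h0
    rw [← hA] at this
    omega
  · have := hlt b r hr h0
    rw [← hB] at this
    omega

/-- A labelling of a finite set by the fibres of a polynomial over two distinct points, such that
only the constant functions factor through both labellings. -/
lemma fibres_of_labellings {L X : Type*} [Field L] [IsAlgClosed L] [Fintype X] {F : L[X]}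
    (hN : (F.natDegree : L) ≠ 0) {a b : L} (hab : a ≠ b) (ρ₁ ρ₂ : X → L)
    (h₁ : (F - C a).roots = Finset.univ.val.map ρ₁)
    (h₂ : (F - C b).roots = Finset.univ.val.map ρ₂)
    (hconst : ∀ h : X → ℚ, (∀ x y, ρ₁ x = ρ₁ y → h x = h y) →
      (∀ x y, ρ₂ x = ρ₂ y → h x = h y) → ∀ x y, h x = h y) :
    (∀ x, ((F - C a).rootMultiplicity (ρ₁ x) : L) ≠ 0) ∧
    (∀ x, ((F - C b).rootMultiplicity (ρ₂ x) : L) ≠ 0) ∧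
    ∃ x, (∀ y, ρ₁ y = ρ₁ x → y = x) ∨ (∀ y, ρ₂ y = ρ₂ x → y = x) := by
  classical
  have hX : Fintype.card X = F.natDegree := by
    have := congrArg Multiset.card h₁
    rw [← (IsAlgClosed.splits (F - C a)).natDegree_eq_card_roots, natDegree_sub_C] at this
    simpa using this.symm
  have hA : (F - C a).roots.toFinset = Finset.univ.image ρ₁ := by rw [h₁]; rfl
  have hB : (F - C b).roots.toFinset = Finset.univ.image ρ₂ := by rw [h₂]; rfl
  have hle := card_image_add_card_image_le ρ₁ ρ₂ hconst
  obtain ⟨hge, hmul⟩ := card_roots_sub_C_add hN hab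
  rw [hA, hB] at hge hmul
  obtain ⟨hm1, hm2⟩ := hmul (by omega)
  refine ⟨fun x => hm1 _ (by rw [h₁]; simp), fun x => hm2 _ (by rw [h₂]; simp), ?_⟩
  by_contra! hcon
  have key : ∀ ρ : X → L, (∀ x, ∃ y, ρ y = ρ x ∧ y ≠ x) →
      2 * (Finset.univ.image ρ).card ≤ Fintype.card X := by
    intro ρ hρ
    refine Finset.mul_card_image_le_card _ 2 fun r hr => ?_
    obtain ⟨x, -, rfl⟩ := Finset.mem_image.1 hr
    obtain ⟨y, hy, hne⟩ := hρ x
    refine Finset.one_lt_card.2 ⟨x, by simp, y, by simp [hy], hne.symm⟩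
  have k1 := key ρ₁ fun x => (hcon x).1
  have k2 := key ρ₂ fun x => (hcon x).2
  omega

lemma exists_algebraMap_eq_of_rootMultiplicity {K L : Type*} [Field K] [IsSepClosed K] [Field L]
    [Algebra K L] [Algebra.IsAlgebraic K L] {P : K[X]} {r : L}
    (h : ((P.map (algebraMap K L)).rootMultiplicity r : L) ≠ 0) :
    ∃ w : K, algebraMap K L w = r := by
  obtain ⟨p, hp⟩ := ExpChar.exists K
  have hP : P ≠ 0 := by rintro rfl; simp at h
  obtain ⟨k, hk⟩ := IsPurelyInseparable.minpoly_eq_X_sub_C_pow K p r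
  have hi := minpoly.irreducible (Algebra.IsIntegral.isIntegral (R := K) r)
  obtain ⟨j, q, hq, hPq⟩ := WfDvdMonoid.max_power_factor hP hi
  have hqr : (q.map (algebraMap K L)).rootMultiplicity r = 0 := by
    apply rootMultiplicity_eq_zero
    intro hr
    exact hq (minpoly.dvd K r (by simpa [IsRoot, eval_map_algebraMap] using hr))
  have hm : (P.map (algebraMap K L)).rootMultiplicity r = p ^ k * j := by
    have hne : (P.map (algebraMap K L)) ≠ 0 := (Polynomial.map_ne_zero_iff (algebraMap K L).injective).2 hP
    have e : P.map (algebraMap K L) = (X - C r) ^ (p ^ k * j) * q.map (algebraMap K L) := by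
      rw [hPq, Polynomial.map_mul, Polynomial.map_pow, hk, pow_mul]
    rw [e] at hne ⊢
    rw [rootMultiplicity_mul hne, hqr, rootMultiplicity_X_sub_C_pow, add_zero]
  have hk0 : p ^ k = 1 := by
    rcases eq_or_ne k 0 with rfl | hk0
    · simp
    rcases hp with _ | hp
    · simp
    · have := charP_of_injective_algebraMap (algebraMap K L).injective p
      refine absurd ?_ h
      rw [hm, Nat.cast_mul, Nat.cast_pow, CharP.cast_eq_zero, zero_pow hk0, zero_mul]
  rw [hk0, pow_one] at hk
  have := minpoly.mem_range_of_degree_eq_one K r (by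
    rw [← degree_map (minpoly K r) (algebraMap K L), hk, degree_X_sub_C])
  simpa using this

lemma natDegree_iterP {K : Type*} [Field K] (f : K[X]) (n : ℕ) :
    (iterP K f n).natDegree = f.natDegree ^ n := by
  induction n with
  | zero => simp [iterP]
  | succ n ih => rw [iterP, natDegree_comp, ih, pow_succ, mul_comm]

lemma aeval_iterP {K A : Type*} [Field K] [CommRing A] [Algebra K A] (f : K[X]) (n : ℕ) (s : A) :
    aeval s (iterP K f n) = (fun x => aeval x f)^[n] s := by
  induction n with
  | zero => simp [iterP]
  | succ n ih => rw [iterP, aeval_comp, ih, Function.iterate_succ_apply']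

/-- The polynomial `fⁿ(x) - t` over `K(t)`. -/
noncomputable def levelPoly (K : Type) [Field K] (f : K[X]) (n : ℕ) : (Fr K)[X] :=
  (iterP K f n).map (algebraMap K (Fr K)) - C RatFunc.X

lemma mem_preimS_iff {K : Type} [Field K] (f : K[X]) (n : ℕ) (s : Sf K) :
    s ∈ preimS K f n ↔ aeval s (levelPoly K f n) = 0 := by
  have h : ∀ n, ∀ s : Sf K, s ∈ preimS K f n ↔ (fun x => aeval x f)^[n] s = tS K := by
    intro n
    induction n with
    | zero => intro s; rfl
    | succ n ih =>
      intro s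
      rw [Function.iterate_succ_apply, ← ih]
      change aeval s (fF K f) ∈ preimS K f n ↔ _
      rw [fF, aeval_map_algebraMap]
  rw [h, levelPoly, map_sub, aeval_map_algebraMap, aeval_iterP, aeval_C, sub_eq_zero]
  rfl

lemma irreducible_map_sub_C_X {K : Type*} [Field K] {F : K[X]} (hF : F.natDegree ≠ 0) :
    Irreducible (F.map (algebraMap K (RatFunc K)) - C RatFunc.X) := by
  have h1 : Irreducible (F.map (C : K →+* K[X]) - C X) := by
    have : F.map (C : K →+* K[X]) - C X = Bivariate.swap (R := K) (-(X - C F)) := by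
      rw [map_neg, map_sub, Bivariate.swap_Y, Bivariate.swap_C]; ring
    rw [this, MulEquiv.irreducible_iff]
    exact (Associated.neg_left (Associated.refl _)).irreducible_iff.2 (irreducible_X_sub_C F)
  have h2 : (F.map (C : K →+* K[X]) - C X).natDegree ≠ 0 := by
    rw [natDegree_sub_C, natDegree_map_eq_of_injective (C_injective)]
    exact hF
  have h3 := (((h1.isPrimitive h2).irreducible_iff_irreducible_map_fraction_map
    (K := RatFunc K))).1 h1
  convert h3 using 1
  rw [Polynomial.map_sub, Polynomial.map_map, map_C, RatFunc.algebraMap_X]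
  rfl

section Level

variable {K : Type} [Field K] {f : K[X]}

lemma natDegree_levelPoly (f : K[X]) (n : ℕ) :
    (levelPoly K f n).natDegree = f.natDegree ^ n := by
  rw [levelPoly, natDegree_sub_C, natDegree_map, natDegree_iterP]

lemma levelPoly_ne_zero (hd : 2 ≤ f.natDegree) (n : ℕ) : levelPoly K f n ≠ 0 := by
  intro h
  have := natDegree_levelPoly f n
  rw [h, natDegree_zero] at this
  exact absurd this.symm (pow_ne_zero n (by omega))

lemma irreducible_levelPoly (hd : 2 ≤ f.natDegree) (n : ℕ) : Irreducible (levelPoly K f n) :=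
  irreducible_map_sub_C_X (by rw [natDegree_iterP]; exact pow_ne_zero n (by omega))

lemma separable_levelPoly (hd : 2 ≤ f.natDegree) (hK : (f.natDegree : K) ≠ 0) (n : ℕ) :
    (levelPoly K f n).Separable := by
  rw [separable_iff_derivative_ne_zero (irreducible_levelPoly hd n)]
  intro h
  have hN : (levelPoly K f n).natDegree ≠ 0 := by
    rw [natDegree_levelPoly]; exact pow_ne_zero n (by omega)
  have h1 := congrArg (fun p => coeff p ((levelPoly K f n).natDegree - 1)) h
  simp only [coeff_derivative, coeff_zero] at h1
  rw [Nat.sub_add_cancel (Nat.pos_of_ne_zero hN)] at h1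
  have e : (((levelPoly K f n).natDegree - 1 : ℕ) : Fr K) + 1 = ((levelPoly K f n).natDegree : Fr K) := by
    exact_mod_cast congrArg (Nat.cast : ℕ → Fr K) (Nat.sub_add_cancel (Nat.pos_of_ne_zero hN))
  rw [e, mul_eq_zero] at h1
  rcases h1 with h1 | h1
  · exact levelPoly_ne_zero hd n (by simpa using h1)
  · rw [natDegree_levelPoly, Nat.cast_pow] at h1
    apply hK
    apply (algebraMap K (Fr K)).injective
    rw [map_natCast, map_zero]
    exact eq_zero_of_pow_eq_zero h1

lemma preimS_eq_rootSet (hd : 2 ≤ f.natDegree) (n : ℕ) :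
    preimS K f n = (levelPoly K f n).rootSet (Sf K) := by
  ext s
  rw [mem_preimS_iff, mem_rootSet]
  exact ⟨fun h => ⟨levelPoly_ne_zero hd n, h⟩, fun h => h.2⟩

lemma splits_levelPoly_Sf (hd : 2 ≤ f.natDegree) (hK : (f.natDegree : K) ≠ 0) (n : ℕ) :
    ((levelPoly K f n).map (algebraMap (Fr K) (Sf K))).Splits := by
  have : IsSepClosed (Sf K) :=
    (inferInstance : IsSepClosure (Fr K) (separableClosure (Fr K) (AlgebraicClosure (Fr K)))).sep_closed
  exact IsSepClosed.splits_codomain _ (separable_levelPoly hd hK n)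

lemma normal_Kinf (hd : 2 ≤ f.natDegree) (hK : (f.natDegree : K) ≠ 0) :
    Normal (Fr K) (Kinf K f) := by
  have h : KinfI K f = ⨆ n, IntermediateField.adjoin (Fr K) ((levelPoly K f n).rootSet (Sf K)) := by
    rw [KinfI, IntermediateField.adjoin_iUnion]
    simp_rw [preimS_eq_rootSet hd]
  have h2 : ∀ n, Normal (Fr K) (IntermediateField.adjoin (Fr K) ((levelPoly K f n).rootSet (Sf K))) :=
    fun n => Normal.of_isSplittingField (hFEp :=
      IntermediateField.adjoin_rootSet_isSplittingField (splits_levelPoly_Sf hd hK n))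
  change Normal (Fr K) (KinfI K f)
  rw [h]
  exact inferInstance

lemma mem_preimK_iff (n : ℕ) (s : Kinf K f) :
    s ∈ preimK K f n ↔ aeval s (levelPoly K f n) = 0 := by
  change (s : Sf K) ∈ preimS K f n ↔ _
  rw [mem_preimS_iff, IntermediateField.aeval_coe, ZeroMemClass.coe_eq_zero]

lemma splits_levelPoly_Kinf (hd : 2 ≤ f.natDegree) (hK : (f.natDegree : K) ≠ 0) (n : ℕ) :
    ((levelPoly K f n).map (algebraMap (Fr K) (Kinf K f))).Splits := by
  refine IntermediateField.splits_of_splits (splits_levelPoly_Sf hd hK n) fun s hs => ?_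
  refine IntermediateField.subset_adjoin _ _ (Set.mem_iUnion.2 ⟨n, ?_⟩)
  rw [preimS_eq_rootSet hd]
  exact hs

lemma exists_gal_apply_eq (hd : 2 ≤ f.natDegree) (hK : (f.natDegree : K) ≠ 0) {n : ℕ}
    {s₁ s₂ : Kinf K f} (h₁ : s₁ ∈ preimK K f n) (h₂ : s₂ ∈ preimK K f n) :
    ∃ σ : Gal K f, σ s₁ = s₂ := by
  have := normal_Kinf hd hK
  rw [mem_preimK_iff] at h₁ h₂
  have ha : IsAlgebraic (Fr K) s₁ := ⟨_, levelPoly_ne_zero hd n, h₁⟩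
  refine minpoly.exists_algEquiv_of_root' ha ?_
  rw [← minpoly.eq_of_irreducible (irreducible_levelPoly hd n) h₁, map_mul, h₂, zero_mul]

lemma exists_mem_apply_eq_of_dense (hd : 2 ≤ f.natDegree) (hK : (f.natDegree : K) ≠ 0) {n : ℕ}
    {H : Subgroup (Gal K f)} (hH : closure (H : Set (Gal K f)) = Set.univ)
    {s₁ s₂ : Kinf K f} (h₁ : s₁ ∈ preimK K f n) (h₂ : s₂ ∈ preimK K f n) :
    ∃ σ ∈ H, σ s₁ = s₂ := by
  have := normal_Kinf hd hK
  obtain ⟨σ, hσ⟩ := exists_gal_apply_eq hd hK h₁ h₂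
  have hopen : IsOpen ((fun τ : Gal K f => σ⁻¹ * τ) ⁻¹' (MulAction.stabilizer (Gal K f) s₁ : Set (Gal K f))) :=
    (stabilizer_isOpen_of_isIntegral s₁).preimage (continuous_const_mul _)
  have hmem : σ ∈ closure (H : Set (Gal K f)) := by rw [hH]; trivial
  obtain ⟨τ, hτ, hτH⟩ := mem_closure_iff.1 hmem _ hopen (by simp)
  refine ⟨τ, hτH, ?_⟩
  have h : (σ⁻¹ * τ) • s₁ = s₁ := hτ
  rw [mul_smul, inv_smul_eq_iff] at h
  exact h.trans hσ

lemma gal_apply_mem_preimK (σ : Gal K f) {n : ℕ} {s : Kinf K f} (hs : s ∈ preimK K f n) :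
    σ s ∈ preimK K f n := by
  rw [mem_preimK_iff] at hs ⊢
  have := (aeval_algHom_apply σ.toAlgHom s (levelPoly K f n))
  rw [hs] at this
  simpa using this

lemma gal_ext {σ τ : Gal K f} (h : ∀ n, ∀ s ∈ preimK K f n, σ s = τ s) : σ = τ := by
  have : σ.toAlgHom = τ.toAlgHom := by
    refine IntermediateField.algHom_ext_of_eq_adjoin (S := KinfI K f) _ rfl fun s hs => ?_
    obtain ⟨n, hn⟩ := Set.mem_iUnion.1 hs
    exact h n ⟨s, _⟩ hn
  exact AlgEquiv.ext fun x => DFunLike.congr_fun this x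

lemma ncard_preimK (hd : 2 ≤ f.natDegree) (hK : (f.natDegree : K) ≠ 0) (n : ℕ) :
    (preimK K f n).ncard = f.natDegree ^ n := by
  have : preimK K f n = (levelPoly K f n).rootSet (Kinf K f) := by
    ext s
    rw [mem_preimK_iff, mem_rootSet]
    exact ⟨fun h => ⟨levelPoly_ne_zero hd n, h⟩, fun h => h.2⟩
  rw [this, ← natDegree_levelPoly, ← card_rootSet_eq_natDegree (separable_levelPoly hd hK n)
    (splits_levelPoly_Kinf hd hK n), Set.ncard_eq_toFinset_card', Set.toFinset_card]

end Level

/-- An integral extension of a ring whose residue ring at the contracted prime is a field `K` has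
residue ring at the prime embeddable in an algebraic closure of `K`. -/
lemma exists_hom_algebraicClosure {K R O S : Type*} [Field K] [CommRing R] [CommRing O]
    [CommRing S] [IsDomain S] [Algebra R O] [Algebra.IsIntegral R O] (i : K →+* R) (u : R)
    (hi : ∀ r, ∃ a, r - i a ∈ Ideal.span {u}) (π : O →+* S) (hπ : Function.Surjective π)
    (hu : π (algebraMap R O u) = 0) :
    ∃ θ : S →+* AlgebraicClosure K,
      ∀ a, θ (π (algebraMap R O (i a))) = algebraMap K (AlgebraicClosure K) a := by
  let ψ : R →+* S := π.comp (algebraMap R O)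
  have hψ : ∀ r, ∃ a, ψ r = ψ.comp i a := by
    intro r
    obtain ⟨a, ha⟩ := hi r
    obtain ⟨c, hc⟩ := Ideal.mem_span_singleton.1 ha
    refine ⟨a, sub_eq_zero.1 ?_⟩
    change ψ r - ψ (i a) = 0
    rw [← map_sub, hc, map_mul, show ψ u = 0 from hu, zero_mul]
  let _ : Algebra K S := (ψ.comp i).toAlgebra
  have hint : Algebra.IsIntegral K S := by
    refine ⟨fun y => ?_⟩
    obtain ⟨x, rfl⟩ := hπ y
    obtain ⟨P, hPm, hP⟩ := Algebra.IsIntegral.isIntegral (R := R) x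
    have hlift : P.map ψ ∈ Polynomial.lifts (ψ.comp i) := by
      rw [Polynomial.lifts_iff_coeff_lifts]
      intro n
      rw [coeff_map]
      obtain ⟨a, ha⟩ := hψ (P.coeff n)
      exact ⟨a, ha.symm⟩
    obtain ⟨Q, hQ, -, hQm⟩ := Polynomial.lifts_and_degree_eq_and_monic hlift (hPm.map ψ)
    refine ⟨Q, hQm, ?_⟩
    change eval₂ (ψ.comp i) _ Q = 0
    rw [eval₂_eq_eval_map, hQ, eval_map, ← hom_eval₂, hP, map_zero]
  have hinj : FaithfulSMul K S :=
    (faithfulSMul_iff_algebraMap_injective _ _).2 (algebraMap K S).injective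
  let θ : S →ₐ[K] AlgebraicClosure K := IsAlgClosed.lift
  exact ⟨θ.toRingHom, fun a => θ.commutes a⟩

section Residue

variable {K : Type} [Field K] {f : K[X]}

/-- The element `t - p` of the coordinate ring `K[t - p]`. -/
noncomputable def uniformizer (K : Type) [Field K] (pt : P1 K) : ↥(Rbase K pt) :=
  ⟨uPt K pt, Algebra.self_mem_adjoin_singleton K _⟩

lemma exists_sub_algebraMap_mem_span (pt : P1 K) (r : ↥(Rbase K pt)) :
    ∃ a : K, r - algebraMap K _ a ∈ Ideal.span {uniformizer K pt} := by
  obtain ⟨r, hr⟩ := r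
  have hr' := hr
  rw [Rbase, Algebra.adjoin_singleton_eq_range_aeval] at hr'
  obtain ⟨q, rfl⟩ := hr'
  refine ⟨q.coeff 0, ?_⟩
  have h : (⟨aeval (uPt K pt) q, hr⟩ : ↥(Rbase K pt)) = aeval (uniformizer K pt) q :=
    Subtype.ext (by
      change _ = (Rbase K pt).val _
      rw [← aeval_algHom_apply]; rfl)
  rw [Ideal.mem_span_singleton]
  refine ⟨aeval (uniformizer K pt) q.divX, ?_⟩
  change (⟨aeval (uPt K pt) q, hr⟩ : ↥(Rbase K pt)) - _ = _
  rw [h]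
  have h2 := congrArg (aeval (uniformizer K pt)) (divX_mul_X_add q)
  rw [map_add, map_mul, aeval_X, aeval_C] at h2
  rw [← h2, add_sub_cancel_right, mul_comm]

lemma exists_residue_hom (pt : P1 K) (𝔓 : Ideal ↥(Oord K f pt)) (h𝔓 : IsPrimeOver K f pt 𝔓) :
    ∃ φ : ↥(Oord K f pt) →+* AlgebraicClosure K,
      (∀ a : K, φ (algebraMap ↥(Rbase K pt) _ (algebraMap K _ a)) = algebraMap K _ a) ∧
      φ (algebraMap ↥(Rbase K pt) _ (uniformizer K pt)) = 0 ∧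
      ∀ x ∈ 𝔓, φ x = 0 := by
  have hp := h𝔓.1
  have hint : Algebra.IsIntegral ↥(Rbase K pt) ↥(Oord K f pt) :=
    (inferInstance : Algebra.IsIntegral ↥(Rbase K pt) ↥(integralClosure ↥(Rbase K pt) (Kinf K f)))
  have hu : Ideal.Quotient.mk 𝔓 (algebraMap ↥(Rbase K pt) _ (uniformizer K pt)) = 0 := by
    refine Ideal.Quotient.eq_zero_iff_mem.2 ?_
    have : uniformizer K pt ∈ Ideal.comap (algebraMap ↥(Rbase K pt) ↥(Oord K f pt)) 𝔓 := by
      rw [h𝔓.2]; exact Ideal.mem_span_singleton_self _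
    exact this
  obtain ⟨θ, hθ⟩ := exists_hom_algebraicClosure (O := ↥(Oord K f pt))
    (S := ↥(Oord K f pt) ⧸ 𝔓) (algebraMap K ↥(Rbase K pt)) (uniformizer K pt)
    (exists_sub_algebraMap_mem_span pt) (Ideal.Quotient.mk 𝔓) Ideal.Quotient.mk_surjective hu
  refine ⟨θ.comp (Ideal.Quotient.mk 𝔓), hθ, ?_, fun x hx => ?_⟩
  · rw [RingHom.comp_apply, hu, map_zero]
  · rw [RingHom.comp_apply, Ideal.Quotient.eq_zero_iff_mem.2 hx, map_zero]

lemma isIntegral_of_mem_preimK (hd : 2 ≤ f.natDegree) (p : K) {n : ℕ} {s : Kinf K f}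
    (hs : s ∈ preimK K f n) : s ∈ Oord K f (Option.some p) := by
  have hF : iterP K f n ≠ 0 := by
    intro h
    have := natDegree_iterP f n
    rw [h, natDegree_zero] at this
    exact absurd this.symm (pow_ne_zero n (by omega))
  rw [mem_preimK_iff, levelPoly, map_sub, aeval_C, sub_eq_zero] at hs
  change IsIntegral ↥(Rbase K (Option.some p)) s
  have hmon : ((iterP K f n * C (iterP K f n).leadingCoeff⁻¹).map
      (algebraMap K ↥(Rbase K (Option.some p)))).Monic :=
    (monic_mul_leadingCoeff_inv hF).map _
  refine IsIntegral.of_aeval_monic hmon ?_ ?_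
  · rw [(monic_mul_leadingCoeff_inv hF).natDegree_map, natDegree_mul_leadingCoeff_inv _ hF,
      natDegree_iterP]
    exact pow_ne_zero n (by omega)
  · have h : aeval s ((iterP K f n * C (iterP K f n).leadingCoeff⁻¹).map
        (algebraMap K ↥(Rbase K (Option.some p)))) =
        algebraMap ↥(Rbase K (Option.some p)) (Kinf K f)
          ((uniformizer K (Option.some p) + algebraMap K _ p) *
            algebraMap K _ (iterP K f n).leadingCoeff⁻¹) := by
      rw [Polynomial.map_mul, map_mul, map_mul, map_C, aeval_C]
      congr 1
      have e : (uniformizer K (Option.some p) + algebraMap K _ p : ↥(Rbase K (Option.some p))) =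
          (RatFunc.X : Fr K) := by
        change (RatFunc.X - algebraMap K (Fr K) p) + algebraMap K (Fr K) p = _
        ring
      change _ = algebraMap (Fr K) (Kinf K f)
        ((uniformizer K (Option.some p) + algebraMap K _ p : ↥(Rbase K (Option.some p))) : Fr K)
      rw [e, ← hs, aeval_def, aeval_def, eval₂_map, eval₂_map]
      rfl
    rw [h]
    exact isIntegral_algebraMap

/-- The elements of `f⁻ⁿ(t)`, labelled by their reductions at a prime over `t - p`. -/
lemma exists_labelling (hd : 2 ≤ f.natDegree) (hK : (f.natDegree : K) ≠ 0) (n : ℕ) (p : K)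
    (𝔓 : Ideal ↥(Oord K f (Option.some p))) (h𝔓 : IsPrimeOver K f (Option.some p) 𝔓) :
    ∃ ρ : (levelPoly K f n).rootSet (Kinf K f) → AlgebraicClosure K,
      ((iterP K f n).map (algebraMap K (AlgebraicClosure K)) -
        C (algebraMap K (AlgebraicClosure K) p)).roots = Finset.univ.val.map ρ ∧
      ∀ σ ∈ inertiaSet K f (Option.some p) 𝔓, ∀ x y : (levelPoly K f n).rootSet (Kinf K f),
        (y : Kinf K f) = σ x → ρ y = ρ x := by
  obtain ⟨φ, hφK, hφu, hφ𝔓⟩ := exists_residue_hom _ 𝔓 h𝔓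
  have hmem : ∀ x : (levelPoly K f n).rootSet (Kinf K f),
      (x : Kinf K f) ∈ Oord K f (Option.some p) := fun x =>
    isIntegral_of_mem_preimK hd p ((mem_preimK_iff n _).2 (mem_rootSet.1 x.2).2)
  refine ⟨fun x => φ ⟨x, hmem x⟩, ?_, ?_⟩
  · set F := iterP K f n with hFdef
    let j : K →+* ↥(Oord K f (Option.some p)) :=
      (algebraMap ↥(Rbase K (Option.some p)) _).comp (algebraMap K _)
    let T : ↥(Oord K f (Option.some p)) :=
      algebraMap ↥(Rbase K (Option.some p)) _ (uniformizer K (Option.some p) + algebraMap K _ p)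
    have hT : ((T : ↥(Oord K f (Option.some p))) : Kinf K f) =
        algebraMap (Fr K) (Kinf K f) RatFunc.X := by
      change algebraMap (Fr K) (Kinf K f) ((RatFunc.X - algebraMap K (Fr K) p) +
        algebraMap K (Fr K) p) = _
      rw [sub_add_cancel]
    have hroots : ((levelPoly K f n).map (algebraMap (Fr K) (Kinf K f))).roots =
        (Finset.univ : Finset ((levelPoly K f n).rootSet (Kinf K f))).val.map Subtype.val := by
      refine (Multiset.Nodup.ext (nodup_roots (separable_levelPoly hd hK n).map)
        (Finset.univ.nodup.map Subtype.val_injective)).2 fun x => ?_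
      simp [mem_rootSet]
    have hprod := (splits_levelPoly_Kinf hd hK n).eq_prod_roots
    rw [hroots] at hprod
    have hO : F.map j - C T = C (j F.leadingCoeff) *
        ∏ x : (levelPoly K f n).rootSet (Kinf K f), (X - C ⟨x, hmem x⟩) := by
      apply Polynomial.map_injective (Oord K f (Option.some p)).val.toRingHom
        Subtype.val_injective
      have e₁ : ((F.map j - C T).map (Oord K f (Option.some p)).val.toRingHom) =
          (levelPoly K f n).map (algebraMap (Fr K) (Kinf K f)) := by
        rw [levelPoly, Polynomial.map_sub, Polynomial.map_sub, Polynomial.map_map,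
          Polynomial.map_map, map_C, map_C, ← hT]
        rfl
      rw [e₁, hprod, Polynomial.map_mul, map_C, Polynomial.map_prod]
      congr 1
      · congr 1
        rw [leadingCoeff_map, levelPoly, leadingCoeff_sub_of_degree_lt, leadingCoeff_map]
        · rfl
        · refine degree_C_le.trans_lt (natDegree_pos_iff_degree_pos.1 ?_)
          rw [natDegree_map, natDegree_iterP]
          exact pow_pos (by omega) n
      · rw [Multiset.map_map]
        refine congrArg Multiset.prod (Multiset.map_congr rfl fun x _ => ?_)
        rw [Polynomial.map_sub, map_X, map_C]
        rfl
    have hbar := congrArg (Polynomial.map φ) hO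
    rw [Polynomial.map_sub, Polynomial.map_map, Polynomial.map_mul, map_C, map_C,
      Polynomial.map_prod] at hbar
    have hφj : φ.comp j = algebraMap K (AlgebraicClosure K) := RingHom.ext hφK
    have hφT : φ T = algebraMap K (AlgebraicClosure K) p := by
      change φ (algebraMap _ _ (_ + _)) = _
      rw [map_add, map_add, hφu, hφK, zero_add]
    have hlc : φ (j F.leadingCoeff) ≠ 0 := by
      rw [← RingHom.comp_apply, hφj, _root_.map_ne_zero, leadingCoeff_ne_zero]
      intro h
      have := natDegree_iterP f n
      rw [← hFdef, h, natDegree_zero] at this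
      exact absurd this.symm (pow_ne_zero n (by omega))
    rw [hφj, hφT] at hbar
    rw [hbar, roots_C_mul _ hlc]
    simp_rw [Polynomial.map_sub, map_X, map_C]
    rw [← roots_multiset_prod_X_sub_C (Finset.univ.val.map _), Multiset.map_map]
    rfl
  · intro σ hσ x y hxy
    obtain ⟨h, h'⟩ := hσ ⟨x, hmem x⟩
    have := hφ𝔓 _ h'
    rw [map_sub, sub_eq_zero] at this
    exact (congrArg φ (Subtype.ext hxy)).trans this

end Residue

/-- If the generators of a dihedral group are involutions and one of them fixes `x`, then the orbit
of `x` is the orbit under the rotations. -/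
lemma exists_zpow_smul_eq_of_mem_closure_pair {G Y : Type*} [Group G] [MulAction G Y] {a b : G}
    (ha : a * a = 1) (hb : b * b = 1) {x : Y} (hx : a • x = x ∨ b • x = x) {σ : G}
    (hσ : σ ∈ Subgroup.closure {a, b}) : ∃ k : ℤ, (a * b) ^ k • x = σ • x := by
  have ha' : a⁻¹ = a := inv_eq_of_mul_eq_one_left ha
  have hb' : b⁻¹ = b := inv_eq_of_mul_eq_one_left hb
  have hinv : (a * b)⁻¹ = b * a := by rw [mul_inv_rev, ha', hb']
  have hac : ∀ k : ℤ, a * (a * b) ^ k = (a * b) ^ (-k) * a := fun k => by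
    have : SemiconjBy a (a * b) (a * b)⁻¹ := by
      rw [SemiconjBy, hinv, ← mul_assoc, mul_assoc b, ha, one_mul, mul_one]
    have := (this.zpow_right k).eq
    rwa [inv_zpow'] at this
  have hbc : ∀ k : ℤ, b * (a * b) ^ k = (a * b) ^ (-k) * b := fun k => by
    have : SemiconjBy b (a * b) (a * b)⁻¹ := by
      rw [SemiconjBy, hinv, mul_assoc]
    have := (this.zpow_right k).eq
    rwa [inv_zpow'] at this
  have hb2 : b = a * (a * b) := by rw [← mul_assoc, ha, one_mul]
  have ha2 : a = a * b * b := by rw [mul_assoc, hb, mul_one]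
  have hstable : ∀ k : ℤ, (∃ l : ℤ, (a * b) ^ l • x = a • (a * b) ^ k • x) ∧
      ∃ l : ℤ, (a * b) ^ l • x = b • (a * b) ^ k • x := by
    intro k
    rcases hx with hx | hx
    · have h : ∀ k : ℤ, (a * b) ^ (-k) • x = a • (a * b) ^ k • x := fun k => by
        rw [smul_smul, hac, mul_smul, hx]
      refine ⟨⟨-k, h k⟩, -(1 + k), ?_⟩
      rw [h, smul_smul, smul_smul, zpow_add, zpow_one, ← mul_assoc, ← hb2]
    · have h : ∀ k : ℤ, (a * b) ^ (-k) • x = b • (a * b) ^ k • x := fun k => by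
        rw [smul_smul, hbc, mul_smul, hx]
      refine ⟨⟨1 + -k, ?_⟩, -k, h k⟩
      rw [zpow_add, zpow_one, mul_smul, h, smul_smul (a * b), ← ha2]
  induction hσ using Subgroup.closure_induction_left with
  | one => exact ⟨0, by simp⟩
  | mul_left y hy z hz ih =>
    obtain ⟨k, hk⟩ := ih
    rw [mul_smul, ← hk]
    rcases hy with rfl | rfl
    exacts [(hstable k).1, (hstable k).2]
  | inv_mul_cancel y hy z hz ih =>
    obtain ⟨k, hk⟩ := ih
    rw [mul_smul, ← hk]
    rcases hy with rfl | rfl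
    · rw [ha']; exact (hstable k).1
    · rw [hb']; exact (hstable k).2

/-- An element with a finite orbit through `x` reaches every point of it by a natural power. -/
lemma exists_pow_smul_eq_zpow_smul {G Y : Type*} [Group G] [MulAction G Y] {c : G} {x : Y}
    {S : Set Y} (hS : S.Finite) (hc : ∀ k : ℕ, c ^ k • x ∈ S) (k : ℤ) :
    ∃ m : ℕ, c ^ m • x = c ^ k • x := by
  obtain ⟨N, hN, hNx⟩ : ∃ N : ℕ, 0 < N ∧ c ^ N • x = x := by
    by_contra! h
    refine Set.infinite_of_injective_forall_mem (f := fun k : ℕ => c ^ k • x) ?_ hc hS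
    have key : ∀ i j : ℕ, i < j → c ^ i • x ≠ c ^ j • x := fun i j hij he => by
      refine h (j - i) (by omega) ?_
      obtain ⟨l, rfl⟩ := Nat.exists_eq_add_of_lt hij
      rw [add_assoc, pow_add, mul_smul, smul_left_cancel_iff] at he
      rw [show i + l + 1 - i = l + 1 by omega]
      exact he.symm
    intro i j hij
    by_contra hne
    rcases Nat.lt_or_gt_of_ne hne with h' | h'
    exacts [key i j h' hij, key j i h' hij.symm]
  refine ⟨(k % N).toNat, ?_⟩
  have h0 : 0 ≤ k % N := Int.emod_nonneg _ (by omega)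
  have hst : c ^ N ∈ MulAction.stabilizer G x := hNx
  have h1 : (c ^ N) ^ (k / N) • x = x := Subgroup.zpow_mem _ hst _
  rw [← zpow_natCast, Int.toNat_of_nonneg h0]
  conv_rhs => rw [← Int.emod_add_mul_ediv k N, zpow_add, mul_smul, zpow_mul, zpow_natCast, h1]

/-- An injection preserving the fibres of a labelling by roots is an involution if the roots have
multiplicity at most two. -/
lemma apply_apply_eq_of_rootMultiplicity_le_two {L X : Type*} [Field L] [Fintype X] {P : L[X]}
    {ρ : X → L} (h : P.roots = Finset.univ.val.map ρ) (hP : ∀ x, P.rootMultiplicity (ρ x) ≤ 2)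
    {σ : X → X} (hσ : Function.Injective σ) (hρ : ∀ x, ρ (σ x) = ρ x) (x : X) : σ (σ x) = x := by
  classical
  by_contra hne
  have h1 : σ x ≠ x := fun e => hne (by rw [e, e])
  have h2 : σ (σ x) ≠ σ x := fun e => h1 (hσ e)
  have h3 : ({x, σ x, σ (σ x)} : Finset X) ⊆ Finset.univ.filter fun y => ρ x = ρ y := by
    intro y hy
    simp only [Finset.mem_insert, Finset.mem_singleton] at hy
    rcases hy with rfl | rfl | rfl <;> simp [hρ]
  have h4 := Finset.card_le_card h3
  rw [Finset.card_eq_three.2 ⟨x, σ x, σ (σ x), h1.symm, Ne.symm hne, h2.symm, rfl⟩] at h4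
  have h5 := hP x
  rw [← count_roots, h, Multiset.count_map] at h5
  exact absurd (h4.trans h5) (by norm_num)

section Main

variable {K : Type} [Field K] {f : K[X]}

lemma rootMultiplicity_le_two [IsSepClosed K] {p : K} (hp : ∀ e ∈ branchSet K f p, e ∣ 2) {n : ℕ}
    (hn : 1 ≤ n) {r : AlgebraicClosure K}
    (hr : ((((iterP K f n).map (algebraMap K (AlgebraicClosure K)) -
      C (algebraMap K (AlgebraicClosure K) p)).rootMultiplicity r : ℕ) : AlgebraicClosure K) ≠ 0) :
    ((iterP K f n).map (algebraMap K (AlgebraicClosure K)) -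
      C (algebraMap K (AlgebraicClosure K) p)).rootMultiplicity r ≤ 2 := by
  rw [← map_C, ← Polynomial.map_sub] at hr ⊢
  obtain ⟨w, rfl⟩ := exists_algebraMap_eq_of_rootMultiplicity hr
  rw [← eq_rootMultiplicity_map (algebraMap K (AlgebraicClosure K)).injective] at hr ⊢
  have hroot : (iterP K f n).eval w = p := by
    by_contra hne
    refine hr ?_
    rw [rootMultiplicity_eq_zero, Nat.cast_zero]
    rw [IsRoot, eval_sub, eval_C, sub_eq_zero]
    exact hne
  refine Nat.le_of_dvd two_pos (hp _ ⟨n, hn, w, hroot, ?_⟩)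
  rw [ldeg, hroot]

lemma involutions_on_level [IsSepClosed K] (hd : 2 ≤ f.natDegree) (hK : (f.natDegree : K) ≠ 0)
    {p₁ p₂ : K} (hne : p₁ ≠ p₂) (h₁ : ∀ e ∈ branchSet K f p₁, e ∣ 2)
    (h₂ : ∀ e ∈ branchSet K f p₂, e ∣ 2) {a b : Gal K f}
    {𝔓₁ : Ideal ↥(Oord K f (Option.some p₁))} (h𝔓₁ : IsPrimeOver K f (Option.some p₁) 𝔓₁)
    (ha : a ∈ inertiaSet K f (Option.some p₁) 𝔓₁)
    {𝔓₂ : Ideal ↥(Oord K f (Option.some p₂))} (h𝔓₂ : IsPrimeOver K f (Option.some p₂) 𝔓₂)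
    (hb : b ∈ inertiaSet K f (Option.some p₂) 𝔓₂)
    (hab : closure ((Subgroup.closure {a, b} : Subgroup (Gal K f)) : Set (Gal K f)) = Set.univ)
    {n : ℕ} (hn : 1 ≤ n) :
    (∀ s ∈ preimK K f n, a (a s) = s) ∧ (∀ s ∈ preimK K f n, b (b s) = s) ∧
      ∃ s ∈ preimK K f n, a s = s ∨ b s = s := by
  have hmem : ∀ s, s ∈ preimK K f n ↔ s ∈ (levelPoly K f n).rootSet (Kinf K f) := fun s => by
    rw [mem_preimK_iff, mem_rootSet]
    exact ⟨fun h => ⟨levelPoly_ne_zero hd n, h⟩, fun h => h.2⟩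
  let act (σ : Gal K f) (x : (levelPoly K f n).rootSet (Kinf K f)) :
      (levelPoly K f n).rootSet (Kinf K f) :=
    ⟨σ x, (hmem _).1 (gal_apply_mem_preimK σ ((hmem _).2 x.2))⟩
  have hact : ∀ σ, Function.Injective (act σ) := fun σ x y hxy =>
    Subtype.ext (σ.injective (congrArg Subtype.val hxy))
  obtain ⟨ρ₁, hρ₁, hi₁⟩ := exists_labelling hd hK n p₁ 𝔓₁ h𝔓₁
  obtain ⟨ρ₂, hρ₂, hi₂⟩ := exists_labelling hd hK n p₂ 𝔓₂ h𝔓₂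
  have hρa : ∀ x, ρ₁ (act a x) = ρ₁ x := fun x => hi₁ a ha x _ rfl
  have hρb : ∀ x, ρ₂ (act b x) = ρ₂ x := fun x => hi₂ b hb x _ rfl
  obtain ⟨hm₁, hm₂, x, hx⟩ := fibres_of_labellings
    (by rw [natDegree_map, natDegree_iterP, Nat.cast_pow]
        refine pow_ne_zero n ?_
        rwa [← map_natCast (algebraMap K (AlgebraicClosure K)), _root_.map_ne_zero])
    ((algebraMap K (AlgebraicClosure K)).injective.ne hne) ρ₁ ρ₂ hρ₁ hρ₂ (by
      intro h hh₁ hh₂ x y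
      have hinv : ∀ σ ∈ Subgroup.closure {a, b}, ∀ x, h (act σ x) = h x := by
        intro σ hσ
        induction hσ using Subgroup.closure_induction with
        | mem σ hσ =>
          rcases hσ with rfl | rfl
          · exact fun x => hh₁ _ _ (hρa x)
          · exact fun x => hh₂ _ _ (hρb x)
        | one => exact fun x => rfl
        | mul σ τ _ _ hσ hτ => exact fun x => (hσ (act τ x)).trans (hτ x)
        | inv σ _ hσ =>
          intro x
          rw [← hσ (act σ⁻¹ x)]
          exact congrArg h (Subtype.ext (σ.apply_symm_apply x))
      obtain ⟨σ, hσ, hxy⟩ := exists_mem_apply_eq_of_dense hd hK hab ((hmem _).2 x.2) ((hmem _).2 y.2)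
      rw [← hinv σ hσ x]
      exact congrArg h (Subtype.ext hxy))
  refine ⟨fun s hs => ?_, fun s hs => ?_, x, (hmem _).2 x.2, ?_⟩
  · exact congrArg Subtype.val (apply_apply_eq_of_rootMultiplicity_le_two hρ₁
      (fun y => rootMultiplicity_le_two h₁ hn (hm₁ y)) (hact a) hρa ⟨s, (hmem s).1 hs⟩)
  · exact congrArg Subtype.val (apply_apply_eq_of_rootMultiplicity_le_two hρ₂
      (fun y => rootMultiplicity_le_two h₂ hn (hm₂ y)) (hact b) hρb ⟨s, (hmem s).1 hs⟩)
  · exact hx.imp (fun hx => congrArg Subtype.val (hx _ (hρa x)))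
      fun hx => congrArg Subtype.val (hx _ (hρb x))

lemma dvd_two_of_hasEuclid22Inf (h : HasEuclid22Inf K f) (p : K) : ∀ e ∈ branchSet K f p, e ∣ 2 := by
  obtain ⟨q₁, q₂, -, h₁, h₂, h₃⟩ := h
  intro e he
  by_cases hp₁ : p = q₁
  · exact h₁.1 e (hp₁ ▸ he)
  by_cases hp₂ : p = q₂
  · exact h₂.1 e (hp₂ ▸ he)
  exact ((h₃ p hp₁ hp₂).1 e he).trans (one_dvd 2)

lemma natCast_natDegree_ne_zero_of_tameAll (hd : 2 ≤ f.natDegree) (h : TameAll K f) :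
    (f.natDegree : K) ≠ 0 := by
  rw [Ne, ringChar.spec]
  rcases h with h | h
  · rw [h, zero_dvd_iff]
    omega
  · exact h Option.none

/-- In a triple with product `1`, each member is generated by the other two. -/
lemma mem_closure_pair_of_prod_eq_one {G ι : Type*} [Group G] {g : ι → G} {i j k : ι}
    (hij : i ≠ j) (hik : i ≠ k) (hjk : j ≠ k) {l : List ι} (hl : l.Nodup)
    (hmem : ∀ x, x ∈ l ↔ x = i ∨ x = j ∨ x = k) (hprod : (l.map g).prod = 1) :
    g k ∈ Subgroup.closure {g i, g j} := by
  have hi : g i ∈ Subgroup.closure {g i, g j} := Subgroup.subset_closure (by simp)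
  have hj : g j ∈ Subgroup.closure {g i, g j} := Subgroup.subset_closure (by simp)
  obtain ⟨s, t, rfl⟩ := List.append_of_mem ((hmem k).2 (by simp))
  have hst : ∀ x ∈ s ++ t, g x ∈ Subgroup.closure {g i, g j} := by
    intro x hx
    have hxk : x ≠ k := by
      rintro rfl
      exact (List.nodup_middle.1 hl).notMem hx
    have hx' : x ∈ s ++ k :: t := by
      simp only [List.mem_append, List.mem_cons] at hx ⊢
      tauto
    rcases (hmem x).1 hx' with rfl | rfl | rfl
    exacts [hi, hj, absurd rfl hxk]
  have hs : (s.map g).prod ∈ Subgroup.closure {g i, g j} :=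
    list_prod_mem (by simpa using fun x hx => hst x (List.mem_append_left t hx))
  have ht : (t.map g).prod ∈ Subgroup.closure {g i, g j} :=
    list_prod_mem (by simpa using fun x hx => hst x (List.mem_append_right s hx))
  rw [List.map_append, List.map_cons, List.prod_append, List.prod_cons] at hprod
  have hk : g k = (s.map g).prod⁻¹ * (t.map g).prod⁻¹ := by
    rw [eq_mul_inv_iff_mul_eq]
    exact (inv_eq_of_mul_eq_one_right hprod).symm
  rw [hk]
  exact mul_mem (inv_mem hs) (inv_mem ht)

end Main

/-- Let `K` be a separably closed field and `f ∈ K[x]` a polynomial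
of degree `d ≥ 2` with euclidean orbifold of type `(2,2,∞)` (tame case), with
`P_f = {p₁, p₂, ∞}`.  Then `G_∞(K,f,t)` is the closure of the subgroup generated by
the two finite inertia generators `g_{p₁}, g_{p₂}`, and `⟨g_{p₁}, g_{p₂}⟩` is infinite
dihedral: both generators have order `2` and their product has infinite order; indeed
`g_{p₁} g_{p₂}` is level-transitive on the preimage tree. -/
theorem euclid22inf_gives_dense_dihedral
    (K : Type) [Field K] [IsSepClosed K] (f : Polynomial K)
    (hd : 2 ≤ f.natDegree) (htame : TameAll K f)
    (p₁ p₂ : K) (hne : p₁ ≠ p₂) (horb : HasEuclid22Inf K f)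
    (hPf : PostCrit K f = {Option.some p₁, Option.some p₂, Option.none})
    (g : P1 K → Gal K f) (hg : InertiaGenFamily K f g) :
    closure ((Subgroup.closure {g (Option.some p₁), g (Option.some p₂)} :
        Subgroup (Gal K f)) : Set (Gal K f)) = Set.univ ∧
    orderOf (g (Option.some p₁)) = 2 ∧ orderOf (g (Option.some p₂)) = 2 ∧
    ¬ IsOfFinOrder (g (Option.some p₁) * g (Option.some p₂)) ∧
    (∀ n : ℕ, ∀ s₁ ∈ preimK K f n, ∀ s₂ ∈ preimK K f n,
      ∃ k : ℕ, ((g (Option.some p₁) * g (Option.some p₂)) ^ k) s₁ = s₂) := by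
  obtain ⟨hin, hgen, hprod⟩ := hg
  have hK := natCast_natDegree_ne_zero_of_tameAll hd htame
  have hmemP : ∀ x, x ∈ PostCrit K f ↔ x = some p₁ ∨ x = some p₂ ∨ x = none := fun x => by
    rw [hPf]; rfl
  obtain ⟨l, hl, hlmem, hlprod⟩ := hprod (by rw [hPf]; exact Set.toFinite _)
  have hinfty := mem_closure_pair_of_prod_eq_one (g := g) (i := some p₁) (j := some p₂) (k := none)
    (by simpa using hne) (by simp) (by simp) hl (fun x => (hlmem x).trans (hmemP x)) hlprod
  have hdense : closure ((Subgroup.closure {g (some p₁), g (some p₂)} :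
      Subgroup (Gal K f)) : Set (Gal K f)) = Set.univ := by
    refine Set.eq_univ_of_univ_subset (hgen.symm.subset.trans (closure_mono ?_))
    refine SetLike.coe_subset_coe.2 ((Subgroup.closure_le _).2 ?_)
    rintro _ ⟨x, hx, rfl⟩
    rcases (hmemP x).1 hx with rfl | rfl | rfl
    · exact Subgroup.subset_closure (by simp)
    · exact Subgroup.subset_closure (by simp)
    · exact hinfty
  obtain ⟨𝔓₁, h𝔓₁, hz₁⟩ := hin _ ((hmemP (some p₁)).2 (by simp))
  obtain ⟨𝔓₂, h𝔓₂, hz₂⟩ := hin _ ((hmemP (some p₂)).2 (by simp))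
  have hI₁ : g (some p₁) ∈ inertiaSet K f (some p₁) 𝔓₁ :=
    hz₁.subset (subset_closure (Subgroup.mem_zpowers _))
  have hI₂ : g (some p₂) ∈ inertiaSet K f (some p₂) 𝔓₂ :=
    hz₂.subset (subset_closure (Subgroup.mem_zpowers _))
  have hlevel := fun (n : ℕ) (hn : 1 ≤ n) => involutions_on_level hd hK hne
    (dvd_two_of_hasEuclid22Inf horb p₁) (dvd_two_of_hasEuclid22Inf horb p₂) h𝔓₁ hI₁ h𝔓₂ hI₂
    hdense hn
  generalize g (some p₁) = a at *
  generalize g (some p₂) = b at *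
  have hzero : ∀ s ∈ preimK K f 0, s = tK K f := fun s hs => Subtype.ext hs
  have ha : a * a = 1 := gal_ext fun n s hs => by
    rcases Nat.eq_zero_or_pos n with rfl | hn
    · rw [hzero s hs]; exact AlgEquiv.commutes _ _
    · exact (hlevel n hn).1 s hs
  have hb : b * b = 1 := gal_ext fun n s hs => by
    rcases Nat.eq_zero_or_pos n with rfl | hn
    · rw [hzero s hs]; exact AlgEquiv.commutes _ _
    · exact (hlevel n hn).2.1 s hs
  have hfin : ∀ n, (preimK K f n).Finite := fun n =>
    Set.finite_of_ncard_pos (by rw [ncard_preimK hd hK]; exact pow_pos (by omega) n)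
  have htrans : ∀ n : ℕ, ∀ s₁ ∈ preimK K f n, ∀ s₂ ∈ preimK K f n,
      ∃ k : ℕ, ((a * b) ^ k) s₁ = s₂ := by
    intro n s₁ hs₁ s₂ hs₂
    rcases Nat.eq_zero_or_pos n with rfl | hn
    · exact ⟨0, (hzero s₁ hs₁).trans (hzero s₂ hs₂).symm⟩
    obtain ⟨x, hx, hfix⟩ := (hlevel n hn).2.2
    obtain ⟨σ, hσ, rfl⟩ := exists_mem_apply_eq_of_dense hd hK hdense hx hs₁
    obtain ⟨τ, hτ, rfl⟩ := exists_mem_apply_eq_of_dense hd hK hdense hx hs₂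
    obtain ⟨i, hi⟩ := exists_zpow_smul_eq_of_mem_closure_pair ha hb (x := x) hfix hσ
    obtain ⟨j, hj⟩ := exists_zpow_smul_eq_of_mem_closure_pair ha hb (x := x) hfix hτ
    obtain ⟨m, hm⟩ := exists_pow_smul_eq_zpow_smul (c := a * b) (x := σ x) (hfin n)
      (fun k => gal_apply_mem_preimK ((a * b) ^ k) hs₁) (j - i)
    refine ⟨m, hm.trans ?_⟩
    change _ • (σ • x) = τ • x
    rw [← hi, ← hj, smul_smul, ← zpow_add, sub_add_cancel]
  have hinf : ¬ IsOfFinOrder (a * b) := by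
    rw [isOfFinOrder_iff_pow_eq_one]
    rintro ⟨m, hm, hab⟩
    have hcard := ncard_preimK hd hK m
    obtain ⟨s, hs⟩ : (preimK K f m).Nonempty :=
      Set.nonempty_of_ncard_ne_zero (by rw [hcard]; exact pow_ne_zero m (by omega))
    have hsub : preimK K f m ⊆ (fun k => ((a * b) ^ k) s) '' Finset.range m := by
      intro s' hs'
      obtain ⟨k, rfl⟩ := htrans m s hs s' hs'
      refine ⟨k % m, by simpa using Nat.mod_lt k hm, ?_⟩
      change ((a * b) ^ (k % m)) s = _
      rw [← pow_eq_pow_mod k hab]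
    have h1 := Set.ncard_le_ncard hsub ((Finset.finite_toSet _).image _)
    have h2 := Set.ncard_image_le (f := fun k => ((a * b) ^ k) s) (Finset.range m).finite_toSet
    rw [Set.ncard_coe_finset, Finset.card_range] at h2
    rw [hcard] at h1
    have h3 := Nat.lt_pow_self (n := m) (show 1 < f.natDegree by omega)
    omega
  refine ⟨hdense, ?_, ?_, hinf, htrans⟩
  · refine orderOf_eq_prime (by rw [pow_two, ha]) fun h => hinf ?_
    rw [h, one_mul, isOfFinOrder_iff_pow_eq_one]
    exact ⟨2, two_pos, by rw [pow_two, hb]⟩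
  · refine orderOf_eq_prime (by rw [pow_two, hb]) fun h => hinf ?_
    rw [h, mul_one, isOfFinOrder_iff_pow_eq_one]
    exact ⟨2, two_pos, by rw [pow_two, ha]⟩

end ArbGal
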